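/- arXiv:1805.06046 — 2 statements merged into one kernel-verified Lean document; each statement's English description precedes it below -/
import Mathlib

section
/- Let N = k·b and identify ℝ^N with vectors indexed by pairs (i,j) ∈ [k]×[b]. Let B be an N×N real matrix, y ∈ ℝ^N, and x* ∈ ℝ^N with x* = B x* + y. Let x_0 ∈ ℝ^N be deterministic and, for t = 0,…,T−1, let P_t : Ω → (k×k real matrices) be random matrices on a probability space (Ω,μ), each almost surely an orthogonal projection (symmetric and idempotent), entrywise integrable with E[P_t] = (1−δ_t)·I_k for some δ_t ∈ [0,1], and with P_t independent of the iterate x_t, where x_{t+1} = (P_t ⊗ I_b)(B x_t + y) + ((I_k − P_t) ⊗ I_b) x_t. Then E[‖x_T − x*‖²] ≤ (∏_{t=0}^{T−1} ((1−δ_t)·‖B‖₂² + δ_t)) · ‖x_0 − x*‖², where ‖B‖₂ is the induced 2-norm of B. -/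
open Matrix MeasureTheory ProbabilityTheory

noncomputable section

/-- Entrywise (pi-type) measurable space on real matrices. -/
instance matrixMeasurableSpace {m n : Type*} : MeasurableSpace (Matrix m n ℝ) :=
  inferInstanceAs (MeasurableSpace (m → n → ℝ))

/-- Squared Euclidean norm of a finitely indexed real vector. -/
def sqnorm {ι : Type*} [Fintype ι] (v : ι → ℝ) : ℝ := ∑ i, (v i) ^ 2

/-- The action of the Kronecker product `A ⊗ I_b` on real vectors indexed by pairs:
`(kronId A v) (i, j) = ∑ l, A i l * v (l, j)`. -/
def kronId {p k b : Type*} [Fintype k] (A : Matrix p k ℝ) (v : k × b → ℝ) : p × b → ℝ :=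
  fun ij => ∑ l, A ij.1 l * v (l, ij.2)

/-- The induced 2-norm (L2 operator norm) of a real matrix: the operator norm of the
associated linear map between Euclidean spaces. -/
def l2OpNorm {m n : Type*} [Fintype m] [Fintype n] [DecidableEq n]
    (M : Matrix m n ℝ) : ℝ :=
  ‖LinearMap.toContinuousLinearMap (Matrix.toEuclideanLin M)‖

section

variable {ι p b : Type*} [Fintype ι] [Fintype p]

lemma sqnorm_eq_norm_sq (v : ι → ℝ) : sqnorm v = ‖WithLp.toLp 2 v‖ ^ 2 := by
  simp [sqnorm, EuclideanSpace.norm_sq_eq]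

lemma sqnorm_nonneg (v : ι → ℝ) : 0 ≤ sqnorm v :=
  Finset.sum_nonneg fun _ _ => sq_nonneg _

lemma measurable_sqnorm : Measurable (sqnorm : (ι → ℝ) → ℝ) := by
  unfold sqnorm
  fun_prop

lemma abs_mul_le_sqnorm (v : ι → ℝ) (i j : ι) : |v i * v j| ≤ sqnorm v := by
  have hle : ∀ l, v l ^ 2 ≤ sqnorm v := fun l =>
    Finset.single_le_sum (f := fun l => v l ^ 2) (fun _ _ => sq_nonneg _) (Finset.mem_univ l)
  have hi := hle i
  have hj := hle j
  rw [abs_le]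
  constructor <;> nlinarith [sq_nonneg (v i + v j), sq_nonneg (v i - v j)]

lemma sqnorm_mulVec_le [DecidableEq ι] (M : Matrix p ι ℝ) (v : ι → ℝ) :
    sqnorm (M.mulVec v) ≤ l2OpNorm M ^ 2 * sqnorm v := by
  have h := (LinearMap.toContinuousLinearMap (Matrix.toEuclideanLin M)).le_opNorm
    (WithLp.toLp 2 v)
  rw [sqnorm_eq_norm_sq, sqnorm_eq_norm_sq, ← mul_pow]
  exact pow_le_pow_left₀ (norm_nonneg _) h 2

lemma dotProduct_proj_update [DecidableEq p] {Q : Matrix p p ℝ} (hs : Qᵀ = Q)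
    (hi : Q * Q = Q) (u e : p → ℝ) :
    (Q.mulVec u + (1 - Q).mulVec e) ⬝ᵥ (Q.mulVec u + (1 - Q).mulVec e)
      = e ⬝ᵥ e + (u ⬝ᵥ Q.mulVec u - e ⬝ᵥ Q.mulVec e) := by
  have h2 : ∀ v w : p → ℝ, Q.mulVec v ⬝ᵥ w = v ⬝ᵥ Q.mulVec w := fun v w => by
    rw [Matrix.dotProduct_mulVec, ← Matrix.mulVec_transpose, hs]
  have h3 : ∀ v w : p → ℝ, v ⬝ᵥ Q.mulVec w = w ⬝ᵥ Q.mulVec v := fun v w => by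
    rw [← h2, dotProduct_comm]
  simp only [Matrix.sub_mulVec, Matrix.one_mulVec, add_dotProduct, dotProduct_add,
    sub_dotProduct, dotProduct_sub, h2]
  simp only [Matrix.mulVec_mulVec, hi]
  rw [h3 e u]
  ring

lemma sqnorm_proj_update [Fintype b] [DecidableEq p] {Q : Matrix p p ℝ} (hs : Qᵀ = Q) (hi : Q * Q = Q)
    (u e : p × b → ℝ) :
    sqnorm (kronId Q u + kronId (1 - Q) e)
      = sqnorm e + ∑ j, ∑ i, ∑ l, Q i l * (u (i, j) * u (l, j) - e (i, j) * e (l, j)) := by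
  have h : ∀ j, ∑ i, (kronId Q u + kronId (1 - Q) e : p × b → ℝ) (i, j) ^ 2 = ∑ i, e (i, j) ^ 2
      + ∑ i, ∑ l, Q i l * (u (i, j) * u (l, j) - e (i, j) * e (l, j)) := fun j => by
    have := dotProduct_proj_update hs hi (fun i => u (i, j)) (fun i => e (i, j))
    simp only [dotProduct, Matrix.mulVec, Pi.add_apply, ← sq, Finset.mul_sum,
      ← Finset.sum_sub_distrib] at this
    simp only [kronId, Pi.add_apply]
    rw [this]
    refine congrArg _ (Finset.sum_congr rfl fun i _ => Finset.sum_congr rfl fun l _ => ?_)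
    ring
  simp only [sqnorm]
  rw [Fintype.sum_prod_type_right, Fintype.sum_prod_type_right (fun a => e a ^ 2),
    ← Finset.sum_add_distrib]
  exact Finset.sum_congr rfl fun j _ => h j

lemma measurable_kronId {Ω : Type*} [MeasurableSpace Ω] {P : Ω → Matrix p p ℝ}
    {v : Ω → p × b → ℝ} (hP : ∀ i j, Measurable fun ω => P ω i j) (hv : Measurable v) :
    Measurable fun ω => kronId (P ω) (v ω) := by
  refine measurable_pi_lambda _ fun a => ?_
  simp only [kronId]
  exact Finset.measurable_sum _ fun l _ => (hP _ _).mul ((measurable_pi_apply _).comp hv)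

lemma integrable_mul_of_integrable_sqnorm {Ω : Type*} [MeasurableSpace Ω] {μ : Measure Ω}
    {v : Ω → ι → ℝ} (hv : Measurable v) (h : Integrable (fun ω => sqnorm (v ω)) μ) (i j : ι) :
    Integrable (fun ω => v ω i * v ω j) μ :=
  h.mono' (by fun_prop) (.of_forall fun ω => abs_mul_le_sqnorm (v ω) i j)

/-- Second moment of one update by a random projection independent of the current state. -/
lemma integrable_integral_sqnorm_proj_update [Fintype b] {Ω : Type*} [MeasurableSpace Ω]
    {μ : Measure Ω} [DecidableEq p] {P : Ω → Matrix p p ℝ}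
    {u e : Ω → p × b → ℝ} {c : ℝ} (hu : Measurable u) (he : Measurable e)
    (hPint : ∀ i j, Integrable (fun ω => P ω i j) μ)
    (hproj : ∀ᵐ ω ∂μ, (P ω)ᵀ = P ω ∧ P ω * P ω = P ω)
    (hEP : ∀ i j, (∫ ω, P ω i j ∂μ) = (c • (1 : Matrix p p ℝ)) i j)
    (hindep : IndepFun P (fun ω => (u ω, e ω)) μ)
    (hui : Integrable (fun ω => sqnorm (u ω)) μ) (hei : Integrable (fun ω => sqnorm (e ω)) μ) :
    Integrable (fun ω => sqnorm (kronId (P ω) (u ω) + kronId (1 - P ω) (e ω))) μ ∧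
      ∫ ω, sqnorm (kronId (P ω) (u ω) + kronId (1 - P ω) (e ω)) ∂μ
        = c * ∫ ω, sqnorm (u ω) ∂μ + (1 - c) * ∫ ω, sqnorm (e ω) ∂μ := by
  have hae : (fun ω => sqnorm (kronId (P ω) (u ω) + kronId (1 - P ω) (e ω))) =ᵐ[μ]
      fun ω => sqnorm (e ω) + ∑ j, ∑ i, ∑ l,
        P ω i l * (u ω (i, j) * u ω (l, j) - e ω (i, j) * e ω (l, j)) := by
    filter_upwards [hproj] with ω hω using sqnorm_proj_update hω.1 hω.2 _ _
  have huu := integrable_mul_of_integrable_sqnorm hu hui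
  have hee := integrable_mul_of_integrable_sqnorm he hei
  have hind : ∀ i l j, IndepFun (fun ω => P ω i l)
      (fun ω => u ω (i, j) * u ω (l, j) - e ω (i, j) * e ω (l, j)) μ := fun i l j =>
    hindep.comp (φ := fun A : Matrix p p ℝ => A i l)
      (ψ := fun w : (p × b → ℝ) × (p × b → ℝ) =>
        w.1 (i, j) * w.1 (l, j) - w.2 (i, j) * w.2 (l, j))
      ((measurable_pi_apply l).comp (measurable_pi_apply i)) (by fun_prop)
  have hint : ∀ i l j, Integrable (fun ω => P ω i l *
      (u ω (i, j) * u ω (l, j) - e ω (i, j) * e ω (l, j))) μ := fun i l j =>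
    (hind i l j).integrable_mul (hPint i l) ((huu _ _).sub (hee _ _))
  have hval : ∀ i l j, ∫ ω, P ω i l *
      (u ω (i, j) * u ω (l, j) - e ω (i, j) * e ω (l, j)) ∂μ
      = (c • (1 : Matrix p p ℝ)) i l *
        ((∫ ω, u ω (i, j) * u ω (l, j) ∂μ) - ∫ ω, e ω (i, j) * e ω (l, j) ∂μ) := fun i l j => by
    rw [← hEP, ← integral_sub (huu _ _) (hee _ _)]
    exact (hind i l j).integral_fun_mul_eq_mul_integral (hPint i l).aestronglyMeasurable
      ((huu _ _).sub (hee _ _)).aestronglyMeasurable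
  have hsum : Integrable (fun ω => ∑ j, ∑ i, ∑ l,
        P ω i l * (u ω (i, j) * u ω (l, j) - e ω (i, j) * e ω (l, j))) μ :=
    integrable_finsetSum _ fun j _ => integrable_finsetSum _ fun i _ =>
      integrable_finsetSum _ fun l _ => hint i l j
  have hsq : ∀ v : Ω → p × b → ℝ, (∀ a a', Integrable (fun ω => v ω a * v ω a') μ) →
      ∫ ω, sqnorm (v ω) ∂μ = ∑ j, ∑ i, ∫ ω, v ω (i, j) * v ω (i, j) ∂μ := fun v hv => by
    simp only [sqnorm, sq]
    rw [integral_finsetSum _ fun a _ => hv a a, Fintype.sum_prod_type_right]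
  refine ⟨(hei.add hsum).congr hae.symm, ?_⟩
  rw [integral_congr_ae hae, integral_add hei hsum,
    integral_finsetSum _ fun j _ => integrable_finsetSum _ fun i _ =>
      integrable_finsetSum _ fun l _ => hint i l j]
  have hinner : ∀ j, ∫ ω, ∑ i, ∑ l,
        P ω i l * (u ω (i, j) * u ω (l, j) - e ω (i, j) * e ω (l, j)) ∂μ
      = c * (∑ i, ∫ ω, u ω (i, j) * u ω (i, j) ∂μ)
        - c * ∑ i, ∫ ω, e ω (i, j) * e ω (i, j) ∂μ := fun j => by
    rw [integral_finsetSum _ fun i _ => integrable_finsetSum _ fun l _ => hint i l j,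
      Finset.mul_sum, Finset.mul_sum, ← Finset.sum_sub_distrib]
    refine Finset.sum_congr rfl fun i _ => ?_
    rw [integral_finsetSum _ fun l _ => hint i l j]
    simp only [hval, Matrix.smul_apply, Matrix.one_apply, smul_eq_mul]
    simp [mul_sub]
  simp only [hinner, Finset.sum_sub_distrib, ← Finset.mul_sum]
  rw [hsq u huu, hsq e hee]
  ring

lemma kronId_error_update [Fintype b] [DecidableEq p]
    {B : Matrix (p × b) (p × b) ℝ} {y xs : p × b → ℝ} (hfix : xs = B.mulVec xs + y)
    (Q : Matrix p p ℝ) (v : p × b → ℝ) :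
    kronId Q (B.mulVec v + y) + kronId (1 - Q) v - xs
      = kronId Q (B.mulVec (v - xs)) + kronId (1 - Q) (v - xs) := by
  have h1 : B.mulVec (v - xs) = B.mulVec v + y - xs := by
    rw [Matrix.mulVec_sub, eq_sub_of_add_eq hfix.symm]
    abel
  rw [h1]
  have hsub : ∀ (A : Matrix p p ℝ) (w : p × b → ℝ), kronId A (w - xs)
      = kronId A w - kronId A xs := fun A w => by
    ext a
    simp [kronId, mul_sub, Finset.sum_sub_distrib]
  have hone : kronId Q xs + kronId (1 - Q) xs = xs := by
    ext a
    simp [kronId, sub_mul, Finset.sum_sub_distrib, Matrix.one_apply]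
  rw [hsub, hsub]
  nth_rw 1 [← hone]
  abel

end

/-- `T`-step geometric convergence of coded power iterations with substitute
decoding. Starting from a deterministic `x_0`, with updates
`x_{t+1} = (P_t ⊗ I_b)(B x_t + y) + ((I - P_t) ⊗ I_b) x_t`, where each `P_t` is a random
orthogonal projection (measurable and entrywise integrable) with `E[P_t] = (1 - δ_t)·I_k`
and `P_t` is independent of `x_t`, one has
`E[‖x_T - x*‖²] ≤ (∏_{t<T} ((1 - δ_t)·‖B‖₂² + δ_t)) · ‖x_0 - x*‖²`. -/
theorem coded_power_iteration_geometric_convergence (k b T : ℕ)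
    {Ω : Type*} [MeasurableSpace Ω] (μ : Measure Ω) [IsProbabilityMeasure μ]
    (B : Matrix (Fin k × Fin b) (Fin k × Fin b) ℝ) (y xstar : Fin k × Fin b → ℝ)
    (hfix : xstar = B.mulVec xstar + y)
    (x0 : Fin k × Fin b → ℝ)
    (δ : ℕ → ℝ) (hδ0 : ∀ t < T, 0 ≤ δ t) (hδ1 : ∀ t < T, δ t ≤ 1)
    (P : ℕ → Ω → Matrix (Fin k) (Fin k) ℝ)
    (x : ℕ → Ω → Fin k × Fin b → ℝ)
    (hx0 : ∀ ω, x 0 ω = x0)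
    (hrec : ∀ t < T, ∀ ω, x (t + 1) ω
      = kronId (P t ω) (B.mulVec (x t ω) + y)
        + kronId ((1 : Matrix (Fin k) (Fin k) ℝ) - P t ω) (x t ω))
    (hPmeas : ∀ t < T, ∀ i j, Measurable fun ω => P t ω i j)
    (hPint : ∀ t < T, ∀ i j, Integrable (fun ω => P t ω i j) μ)
    (hproj : ∀ t < T, ∀ᵐ ω ∂μ, (P t ω)ᵀ = P t ω ∧ P t ω * P t ω = P t ω)
    (hEP : ∀ t < T, ∀ i j,
      (∫ ω, P t ω i j ∂μ) = ((1 - δ t) • (1 : Matrix (Fin k) (Fin k) ℝ)) i j)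
    (hindep : ∀ t < T, IndepFun (P t) (x t) μ) :
    (∫ ω, sqnorm (x T ω - xstar) ∂μ)
      ≤ (∏ t ∈ Finset.range T, ((1 - δ t) * l2OpNorm B ^ 2 + δ t))
          * sqnorm (x0 - xstar) := by
  have key : ∀ t ≤ T, Measurable (x t) ∧ Integrable (fun ω => sqnorm (x t ω - xstar)) μ ∧
      (∫ ω, sqnorm (x t ω - xstar) ∂μ)
        ≤ (∏ s ∈ Finset.range t, ((1 - δ s) * l2OpNorm B ^ 2 + δ s))
          * sqnorm (x0 - xstar) := by
    intro t
    induction t with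
    | zero =>
      intro _
      simp only [hx0]
      refine ⟨?_, integrable_const _, by simp⟩
      rw [funext hx0]
      exact measurable_const
    | succ t ih =>
      intro ht
      obtain ⟨hm, hi, hb⟩ := ih (by omega)
      have hB : Measurable fun v : Fin k × Fin b → ℝ => B.mulVec v := by
        unfold Matrix.mulVec dotProduct
        fun_prop
      have he : Measurable fun ω => x t ω - xstar := hm.sub_const _
      have hu : Measurable fun ω => B.mulVec (x t ω - xstar) := hB.comp he
      have hui : Integrable (fun ω => sqnorm (B.mulVec (x t ω - xstar))) μ :=
        (hi.const_mul (l2OpNorm B ^ 2)).mono' (measurable_sqnorm.comp hu).aestronglyMeasurable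
          (.of_forall fun ω => by
            rw [Real.norm_of_nonneg (sqnorm_nonneg _)]
            exact sqnorm_mulVec_le _ _)
      have hind : IndepFun (P t) (fun ω => (B.mulVec (x t ω - xstar), x t ω - xstar)) μ :=
        (hindep t ht).comp (φ := id) (ψ := fun v => (B.mulVec (v - xstar), v - xstar))
          measurable_id
          ((hB.comp (measurable_id.sub_const _)).prodMk (measurable_id.sub_const _))
      have hstep := integrable_integral_sqnorm_proj_update hu he (hPint t ht) (hproj t ht)
        (hEP t ht) hind hui hi
      have hfun : ∀ ω, x (t + 1) ω - xstar = kronId (P t ω) (B.mulVec (x t ω - xstar))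
          + kronId (1 - P t ω) (x t ω - xstar) := fun ω => by
        rw [hrec t ht, kronId_error_update hfix]
      simp only [hfun]
      refine ⟨?_, hstep.1, ?_⟩
      · rw [funext (hrec t ht)]
        refine (measurable_kronId (hPmeas t ht) ((hB.comp hm).add_const y)).add
          (measurable_kronId (fun i j => ?_) hm)
        exact (hPmeas t ht i j).const_sub _
      · have hle : ∫ ω, sqnorm (B.mulVec (x t ω - xstar)) ∂μ
            ≤ l2OpNorm B ^ 2 * ∫ ω, sqnorm (x t ω - xstar) ∂μ := by
          rw [← integral_const_mul]
          exact integral_mono hui (hi.const_mul _) fun ω => sqnorm_mulVec_le _ _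
        have h0 := hδ0 t ht
        have h1 : 0 ≤ 1 - δ t := sub_nonneg.2 (hδ1 t ht)
        rw [hstep.2, Finset.prod_range_succ]
        calc _ ≤ (1 - δ t) * (l2OpNorm B ^ 2 * ∫ ω, sqnorm (x t ω - xstar) ∂μ)
                + (1 - (1 - δ t)) * ∫ ω, sqnorm (x t ω - xstar) ∂μ := by gcongr
          _ = ((1 - δ t) * l2OpNorm B ^ 2 + δ t) * ∫ ω, sqnorm (x t ω - xstar) ∂μ := by ring
          _ ≤ ((1 - δ t) * l2OpNorm B ^ 2 + δ t) * _ :=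
            mul_le_mul_of_nonneg_left hb (by positivity)
          _ = _ := by ring
  exact (key T le_rfl).2.2

end
end

section
/- Let G be a simple graph on N vertices, let 0 < ε < 1 and D > 0 be real numbers, and suppose every vertex v of G has degree deg(v) satisfying D(1−ε) < deg(v) < D(1+ε) and deg(v) ≥ 1. Let A be the column-normalized adjacency matrix of G, i.e., A(i,j) = 1/deg(j) if i and j are adjacent and 0 otherwise. Then ‖A‖₂ ≤ √((1+ε)/(1−ε)), where ‖·‖₂ denotes the induced 2-norm. -/
open Matrix

noncomputable section

/-- **Schur test**: a matrix with nonnegative entries, row sums at most `R` and column sums at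
most `C` has L2 operator norm at most `√(R * C)`. -/
theorem l2OpNorm_le_sqrt_of_sum_le {m n : Type*} [Fintype m] [Fintype n] [DecidableEq n]
    {M : Matrix m n ℝ} {R C : ℝ} (hM : ∀ i j, 0 ≤ M i j) (hR : 0 ≤ R)
    (hrow : ∀ i, ∑ j, M i j ≤ R) (hcol : ∀ j, ∑ i, M i j ≤ C) :
    l2OpNorm M ≤ Real.sqrt (R * C) := by
  refine ContinuousLinearMap.opNorm_le_bound _ (Real.sqrt_nonneg _) fun x ↦ ?_
  rw [EuclideanSpace.norm_eq, EuclideanSpace.norm_eq,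
    ← Real.sqrt_mul' _ (Finset.sum_nonneg fun i _ ↦ sq_nonneg _)]
  refine Real.sqrt_le_sqrt ?_
  simp only [Real.norm_eq_abs, sq_abs, LinearMap.coe_toContinuousLinearMap',
    Matrix.toLpLin_apply, Matrix.mulVec, dotProduct]
  calc ∑ i, (∑ j, M i j * x j) ^ 2
      ≤ ∑ i, R * ∑ j, M i j * x j ^ 2 := by
        refine Finset.sum_le_sum fun i _ ↦ ?_
        have h_nonneg : ∀ j, 0 ≤ M i j * x j ^ 2 := fun j ↦ mul_nonneg (hM i j) (sq_nonneg _)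
        refine (Finset.sum_sq_le_sum_mul_sum_of_sq_le_mul _ (fun j _ ↦ hM i j)
          (fun j _ ↦ h_nonneg j) fun j _ ↦ le_of_eq (by ring)).trans ?_
        exact mul_le_mul_of_nonneg_right (hrow i) (Finset.sum_nonneg fun j _ ↦ h_nonneg j)
    _ = R * ∑ j, (∑ i, M i j) * x j ^ 2 := by
        rw [← Finset.mul_sum, Finset.sum_comm]
        simp only [Finset.sum_mul]
    _ ≤ R * ∑ j, C * x j ^ 2 := by
        gcongr with j
        exact hcol j
    _ = R * C * ∑ j, x j ^ 2 := by rw [← Finset.mul_sum, mul_assoc]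

/-- if every vertex of a simple graph `G` on `N` vertices has degree at least 1
and in the range `(D(1-ε), D(1+ε))` with `0 < ε < 1`, `D > 0`, then the column-normalized
adjacency matrix `A` (with `A i j = 1/deg(j)` if `i ~ j` and `0` otherwise) satisfies
`‖A‖₂ ≤ √((1+ε)/(1-ε))`. -/
theorem l2OpNorm_colNormalized_adjacency (N : ℕ) (G : SimpleGraph (Fin N))
    [DecidableRel G.Adj] (ε D : ℝ) (hε0 : 0 < ε) (hε1 : ε < 1) (hD : 0 < D)
    (hdeg : ∀ v : Fin N,
      D * (1 - ε) < (G.degree v : ℝ) ∧ (G.degree v : ℝ) < D * (1 + ε) ∧ 1 ≤ G.degree v)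
    (A : Matrix (Fin N) (Fin N) ℝ)
    (hA : ∀ i j, A i j = if G.Adj i j then 1 / (G.degree j : ℝ) else 0) :
    l2OpNorm A ≤ Real.sqrt ((1 + ε) / (1 - ε)) := by
  have hε : 0 < 1 - ε := by linarith
  rw [← mul_one ((1 + ε) / (1 - ε))]
  refine l2OpNorm_le_sqrt_of_sum_le (fun i j ↦ ?_) (by positivity) (fun i ↦ ?_) fun j ↦ ?_
  · rw [hA]
    split_ifs <;> positivity
  · calc ∑ j, A i j
        ≤ ∑ j, if G.Adj i j then 1 / (D * (1 - ε)) else 0 := by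
          refine Finset.sum_le_sum fun j _ ↦ ?_
          rw [hA]
          split_ifs
          · exact one_div_le_one_div_of_le (by positivity) (hdeg j).1.le
          · exact le_rfl
      _ = G.degree i / (D * (1 - ε)) := by
          rw [← Finset.sum_filter, ← G.neighborFinset_eq_filter, Finset.sum_const,
            G.card_neighborFinset_eq_degree, nsmul_eq_mul, mul_one_div]
      _ ≤ D * (1 + ε) / (D * (1 - ε)) := by
          gcongr
          exact (hdeg i).2.1.le
      _ = (1 + ε) / (1 - ε) := mul_div_mul_left _ _ hD.ne'
  · have h_deg_ne : (G.degree j : ℝ) ≠ 0 :=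
      Nat.cast_ne_zero.mpr (Nat.one_le_iff_ne_zero.mp (hdeg j).2.2)
    simp only [hA, G.adj_comm _ j]
    rw [← Finset.sum_filter, ← G.neighborFinset_eq_filter, Finset.sum_const,
      G.card_neighborFinset_eq_degree, nsmul_eq_mul, mul_one_div_cancel h_deg_ne]

end
end
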